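/- Let W be a weight matrix function on a finite interval [a,b] with a < b, normalized so that ∫_a^b W(x) dx = I, and let (P_n)_{n≥0} be a sequence of orthonormal matrix polynomials with respect to W. For each n ≥ 1 let x_1^{(n)},...,x_{k_n}^{(n)} ∈ [a,b] be the distinct zeros of P_n with multiplicities m_i^{(n)} summing to np, let v_{i,j}^{(n)} (j = 1,...,m_i^{(n)}) be linearly independent vectors in the kernel of P_n(x_i^{(n)}) such that the associated matrix col(X^{(n)}(J^{(n)})^l)_{l=0}^{n-1} is invertible, and let Λ_i^{(n)} = (v_{i,1}^{(n)} ... v_{i,m_i^{(n)}}^{(n)})·(L_i^{(n)})^{-1}·((v_{i,1}^{(n)})^T; ...; (v_{i,m_i^{(n)}}^{(n)})^T) be the Gaussian quadrature coefficients, where (L_i^{(n)})_{s,t} = (v_{i,s}^{(n)})^T·(Σ_{l=0}^{n-1} P_l(x_i^{(n)})^T·P_l(x_i^{(n)}))·v_{i,t}^{(n)}. Then for all continuous matrix functions F, G : [a,b] → ℝ^{p×p}: lim_{n→∞} Σ_{i=1}^{k_n} F(x_i^{(n)})·Λ_i^{(n)}·G(x_i^{(n)})^T = ∫_a^b F(x)·W(x)·G(x)^T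 dx. -/

import Mathlib

open Polynomial Matrix MeasureTheory

/-- Evaluation of a `p × p` matrix polynomial at a real number `x`
(entrywise evaluation, i.e. evaluation at the scalar matrix `x • 1`). -/
noncomputable def mev {p : ℕ} (P : Polynomial (Matrix (Fin p) (Fin p) ℝ)) (x : ℝ) :
    Matrix (Fin p) (Fin p) ℝ :=
  P.eval (x • (1 : Matrix (Fin p) (Fin p) ℝ))

/-- Entrywise integral of a matrix-valued function over `[a, b]`. -/
noncomputable def mInt {p : ℕ} (a b : ℝ) (F : ℝ → Matrix (Fin p) (Fin p) ℝ) :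
    Matrix (Fin p) (Fin p) ℝ :=
  Matrix.of fun i j => ∫ x in a..b, F x i j

/-- `W` is a weight matrix function on `[a, b]`: it takes symmetric values on `[a, b]`,
is measurable and (entrywise) integrable on `[a, b]`, is positive semidefinite almost
everywhere on `[a, b]`, and has nonzero determinant almost everywhere on `[a, b]`. -/
def IsWeight (p : ℕ) (a b : ℝ) (W : ℝ → Matrix (Fin p) (Fin p) ℝ) : Prop :=
  (∀ x ∈ Set.Icc a b, (W x).IsSymm) ∧
  (∀ i j, Measurable fun x => W x i j) ∧
  (∀ i j, IntervalIntegrable (fun x => W x i j) volume a b) ∧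
  (∀ᵐ x ∂volume.restrict (Set.Icc a b), (W x).PosSemidef) ∧
  (∀ᵐ x ∂volume.restrict (Set.Icc a b), (W x).det ≠ 0)

/-- `P` is a sequence of orthonormal matrix polynomials with respect to the weight
matrix `W` on `[a, b]`: `deg Pₙ = n`, the leading coefficients are invertible,
`P₀ = I` and `∫_a^b Pₙ(x) W(x) Pₘ(x)ᵀ dx = δₙₘ I`. -/
def IsOrthonormal (p : ℕ) (a b : ℝ) (W : ℝ → Matrix (Fin p) (Fin p) ℝ)
    (P : ℕ → Polynomial (Matrix (Fin p) (Fin p) ℝ)) : Prop :=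
  (∀ n, (P n).natDegree = n) ∧ (∀ n, IsUnit (P n).leadingCoeff) ∧ P 0 = 1 ∧
  ∀ n m : ℕ,
    mInt a b (fun x => mev (P n) x * W x * (mev (P m) x)ᵀ) =
      if n = m then 1 else 0

/-- Index type for the columns of `X`: the vector `v_{i,j}` corresponds to the index
`⟨i, j⟩` (the columns are ordered by `i`, then `j`). -/
abbrev LagIdx (k : ℕ) (m : Fin k → ℕ) : Type := (i : Fin k) × Fin (m i)

/-- The `p × np` matrix `X` whose columns are the vectors `v_{i,j}`. -/
def Xmat {p k : ℕ} (m : Fin k → ℕ) (v : (i : Fin k) → Fin (m i) → Fin p → ℝ) :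
    Matrix (Fin p) (LagIdx k m) ℝ :=
  Matrix.of fun r a => v a.1 a.2 r

/-- The `np × np` diagonal matrix `J` with `x_i` repeated `m_i` times. -/
noncomputable def Jmat {k : ℕ} (x : Fin k → ℝ) (m : Fin k → ℕ) :
    Matrix (LagIdx k m) (LagIdx k m) ℝ :=
  Matrix.diagonal fun a => x a.1

/-- The `np × np` block matrix `col(X Jˡ)_{l=0}^{n-1}` whose `l`-th block row is
`X Jˡ`, realized as a square matrix via the identification
`e : Fin n × Fin p ≃ LagIdx k m` of the column indices. -/
noncomputable def colLag {p n k : ℕ} (x : Fin k → ℝ) (m : Fin k → ℕ)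
    (v : (i : Fin k) → Fin (m i) → Fin p → ℝ)
    (e : (Fin n × Fin p) ≃ LagIdx k m) :
    Matrix (Fin n × Fin p) (Fin n × Fin p) ℝ :=
  Matrix.of fun lr c => (Xmat m v * Jmat x m ^ (lr.1 : ℕ)) lr.2 (e c)

/-- The kernel `K_{n-1}(t, y) = ∑_{l=0}^{n-1} P_l(y)ᵀ P_l(t)`. -/
noncomputable def Kker {p : ℕ} (P : ℕ → Polynomial (Matrix (Fin p) (Fin p) ℝ))
    (n : ℕ) (y t : ℝ) : Matrix (Fin p) (Fin p) ℝ :=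
  ∑ l ∈ Finset.range n, (mev (P l) y)ᵀ * mev (P l) t

/-- The `p × m_i` matrix `(v_{i,1} ⋯ v_{i,m_i})`. -/
def Vmat {p k : ℕ} (m : Fin k → ℕ) (v : (i : Fin k) → Fin (m i) → Fin p → ℝ)
    (i : Fin k) : Matrix (Fin p) (Fin (m i)) ℝ :=
  Matrix.of fun r j => v i j r

/-- The `m_i × m_i` matrix `L_i` with entries `(L_i)_{s,t} = v_{i,s}ᵀ K_{n-1}(x_i, x_i) v_{i,t}`. -/
noncomputable def Lmat {p k : ℕ} (P : ℕ → Polynomial (Matrix (Fin p) (Fin p) ℝ))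
    (n : ℕ) (x : Fin k → ℝ) (m : Fin k → ℕ)
    (v : (i : Fin k) → Fin (m i) → Fin p → ℝ) (i : Fin k) :
    Matrix (Fin (m i)) (Fin (m i)) ℝ :=
  Matrix.of fun s t => v i s ⬝ᵥ (Kker P n (x i) (x i) *ᵥ v i t)

/-- The Gaussian quadrature coefficient
`Λ_i = (v_{i,1} ⋯ v_{i,m_i}) L_i⁻¹ (v_{i,1}ᵀ; ⋯; v_{i,m_i}ᵀ)`. -/
noncomputable def Lam {p k : ℕ} (P : ℕ → Polynomial (Matrix (Fin p) (Fin p) ℝ))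
    (n : ℕ) (x : Fin k → ℝ) (m : Fin k → ℕ)
    (v : (i : Fin k) → Fin (m i) → Fin p → ℝ) (i : Fin k) :
    Matrix (Fin p) (Fin p) ℝ :=
  Vmat m v i * (Lmat P n x m v i)⁻¹ * (Vmat m v i)ᵀ

section MatrixPolynomial

variable {p : ℕ}

lemma mev_sum_C_mul {ι : Type*} (s : Finset ι) (c : ι → Matrix (Fin p) (Fin p) ℝ)
    (P : ι → Polynomial (Matrix (Fin p) (Fin p) ℝ)) (x : ℝ) :
    mev (∑ l ∈ s, C (c l) * P l) x = ∑ l ∈ s, c l * mev (P l) x := by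
  simp [mev, eval_finsetSum, eval_C_mul]

lemma mev_X_mul (P : Polynomial (Matrix (Fin p) (Fin p) ℝ)) (x : ℝ) :
    mev (X * P) x = x • mev P x := by
  rw [mev, X_mul, eval_mul_X]
  simp [mev]

lemma mev_X_pow (l : ℕ) (x : ℝ) :
    mev (X ^ l : Polynomial (Matrix (Fin p) (Fin p) ℝ)) x = x ^ l • 1 := by
  rw [mev, ← one_mul (X ^ l), eval_mul_X_pow]
  simp [_root_.smul_pow]

lemma mev_one (x : ℝ) : mev (1 : Polynomial (Matrix (Fin p) (Fin p) ℝ)) x = 1 := by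
  simp [mev]

lemma mev_map_algebraMap (q : ℝ[X]) (x : ℝ) :
    mev (q.map (algebraMap ℝ (Matrix (Fin p) (Fin p) ℝ))) x = q.eval x • 1 := by
  rw [mev, ← Algebra.algebraMap_eq_smul_one, eval_map_algebraMap, aeval_algebraMap_apply,
    Algebra.algebraMap_eq_smul_one, coe_aeval_eq_eval]

lemma continuous_mev (P : Polynomial (Matrix (Fin p) (Fin p) ℝ)) (r c : Fin p) :
    Continuous fun x => mev P x r c := by
  have h : Continuous fun x => mev P x :=
    P.continuous.comp (continuous_id.smul continuous_const)
  exact h.matrix_elem r c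

/-- A polynomial of degree less than `N` is a left combination of the first `N` members of a
sequence `P` with `deg P n = n` and invertible leading coefficients. -/
lemma exists_eq_sum_C_mul {R : Type*} [Ring R] {P : ℕ → R[X]} (hdeg : ∀ n, (P n).natDegree = n)
    (hlead : ∀ n, IsUnit (P n).leadingCoeff) (N : ℕ) (Q : R[X]) (hQ : Q.degree < N) :
    ∃ c : ℕ → R, Q = ∑ l ∈ Finset.range N, C (c l) * P l := by
  induction N generalizing Q with
  | zero =>
    refine ⟨0, ?_⟩
    have : Q = 0 := by
      ext i
      exact (degree_lt_iff_coeff_zero Q 0).1 hQ i (Nat.zero_le i)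
    simp [this]
  | succ N ih =>
    obtain ⟨u, hu⟩ := hlead N
    obtain ⟨c, hc⟩ := ih (Q - C (Q.coeff N * ↑u⁻¹) * P N) (by
      rw [degree_lt_iff_coeff_zero] at hQ ⊢
      intro i hi
      rw [coeff_sub, coeff_C_mul]
      rcases hi.eq_or_lt with rfl | hi
      · have : (P N).coeff N = u := by rw [hu, leadingCoeff, hdeg]
        simp [this, mul_assoc]
      · rw [hQ i hi, coeff_eq_zero_of_natDegree_lt (p := P N) (by rwa [hdeg]), mul_zero, sub_zero])
    refine ⟨Function.update c N (Q.coeff N * ↑u⁻¹), ?_⟩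
    rw [Finset.sum_range_succ, Function.update_self, ← sub_eq_iff_eq_add, hc]
    refine Finset.sum_congr rfl fun l hl => ?_
    rw [Function.update_of_ne (Finset.mem_range.1 hl).ne]

end MatrixPolynomial

section WeightedIntegral

variable {p : ℕ} {a b : ℝ} {W : ℝ → Matrix (Fin p) (Fin p) ℝ}

lemma mul_mul_transpose_apply {ι : Type*} [Fintype ι] (A B D : Matrix ι ι ℝ) (r c : ι) :
    (A * B * Dᵀ) r c = ∑ t, ∑ s, A r s * D c t * B s t := by
  simp only [Matrix.mul_apply, transpose_apply, Finset.sum_mul]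
  exact Finset.sum_congr rfl fun t _ => Finset.sum_congr rfl fun s _ => by ring

lemma intervalIntegrable_fun_sum {ι : Type*} (s : Finset ι) {f : ι → ℝ → ℝ}
    (hf : ∀ l ∈ s, IntervalIntegrable (f l) volume a b) :
    IntervalIntegrable (fun x => ∑ l ∈ s, f l x) volume a b := by
  simpa only [← Finset.sum_apply] using IntervalIntegrable.sum s hf

lemma intervalIntegrable_mul_weight (hab : a < b)
    (hW : ∀ i j, IntervalIntegrable (fun x => W x i j) volume a b) {f : ℝ → ℝ}
    (hf : ContinuousOn f (Set.Icc a b)) (s t : Fin p) :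
    IntervalIntegrable (fun x => f x * W x s t) volume a b :=
  (hW s t).continuousOn_mul (by rwa [Set.uIcc_of_le hab.le])

lemma intervalIntegrable_mul_weight_mul (hab : a < b)
    (hW : ∀ i j, IntervalIntegrable (fun x => W x i j) volume a b)
    {F G : ℝ → Matrix (Fin p) (Fin p) ℝ}
    (hF : ∀ r c, ContinuousOn (fun t => F t r c) (Set.Icc a b))
    (hG : ∀ r c, ContinuousOn (fun t => G t r c) (Set.Icc a b)) (r c : Fin p) :
    IntervalIntegrable (fun x => (F x * W x * (G x)ᵀ) r c) volume a b := by
  simp only [mul_mul_transpose_apply]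
  refine intervalIntegrable_fun_sum _ fun t _ => intervalIntegrable_fun_sum _ fun s _ => ?_
  exact intervalIntegrable_mul_weight hab hW ((hF r s).mul (hG c t)) s t

lemma mInt_mul_weight_mul_apply (hab : a < b)
    (hW : ∀ i j, IntervalIntegrable (fun x => W x i j) volume a b)
    {F G : ℝ → Matrix (Fin p) (Fin p) ℝ}
    (hF : ∀ r c, ContinuousOn (fun t => F t r c) (Set.Icc a b))
    (hG : ∀ r c, ContinuousOn (fun t => G t r c) (Set.Icc a b)) (r c : Fin p) :
    mInt a b (fun x => F x * W x * (G x)ᵀ) r c =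
      ∑ t, ∑ s, ∫ x in a..b, F x r s * G x c t * W x s t := by
  have hint : ∀ s t, IntervalIntegrable (fun x => F x r s * G x c t * W x s t) volume a b :=
    fun s t => intervalIntegrable_mul_weight hab hW ((hF r s).mul (hG c t)) s t
  simp only [mInt, Matrix.of_apply, mul_mul_transpose_apply]
  rw [intervalIntegral.integral_finsetSum
    fun t _ => intervalIntegrable_fun_sum _ fun s _ => hint s t]
  exact Finset.sum_congr rfl fun t _ =>
    intervalIntegral.integral_finsetSum fun s _ => hint s t

lemma mInt_sum_mul {ι : Type*} (s : Finset ι) (c : ι → Matrix (Fin p) (Fin p) ℝ)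
    (f : ι → ℝ → Matrix (Fin p) (Fin p) ℝ)
    (hf : ∀ l i j, IntervalIntegrable (fun x => f l x i j) volume a b) :
    mInt a b (fun x => ∑ l ∈ s, c l * f l x) = ∑ l ∈ s, c l * mInt a b (f l) := by
  ext i j
  simp only [mInt, Matrix.of_apply, Matrix.sum_apply, Matrix.mul_apply]
  rw [intervalIntegral.integral_finsetSum
    fun l _ => intervalIntegrable_fun_sum _ fun r _ => (hf l r j).const_mul _]
  refine Finset.sum_congr rfl fun l _ => ?_
  rw [intervalIntegral.integral_finsetSum fun r _ => (hf l r j).const_mul _]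
  simp

lemma IsOrthonormal.mInt_sum_C_mul (hab : a < b) (hW : IsWeight p a b W)
    {P : ℕ → Polynomial (Matrix (Fin p) (Fin p) ℝ)} (hP : IsOrthonormal p a b W P) (N : ℕ)
    (c : ℕ → Matrix (Fin p) (Fin p) ℝ) {j : ℕ} (hj : j < N) :
    mInt a b (fun x => mev (∑ l ∈ Finset.range N, C (c l) * P l) x * W x * (mev (P j) x)ᵀ) =
      c j := by
  simp only [mev_sum_C_mul, Finset.sum_mul, Matrix.mul_assoc (c _)]
  rw [mInt_sum_mul _ _ (fun l x => mev (P l) x * W x * (mev (P j) x)ᵀ)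
    fun l => intervalIntegrable_mul_weight_mul hab hW.2.2.1
      (fun r c => (continuous_mev _ r c).continuousOn)
      (fun r c => (continuous_mev _ r c).continuousOn)]
  simp [hP.2.2.2, hj]

lemma mInt_X_mul_comm (hab : a < b) (hW : ∀ x ∈ Set.Icc a b, (W x).IsSymm)
    (Q R : Polynomial (Matrix (Fin p) (Fin p) ℝ)) :
    (mInt a b fun x => mev (X * Q) x * W x * (mev R x)ᵀ)ᵀ =
      mInt a b fun x => mev (X * R) x * W x * (mev Q x)ᵀ := by
  ext i j
  simp only [mInt, transpose_apply, Matrix.of_apply]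
  refine intervalIntegral.integral_congr fun x hx => ?_
  rw [Set.uIcc_of_le hab.le] at hx
  have h : (mev (X * Q) x * W x * (mev R x)ᵀ)ᵀ = mev (X * R) x * W x * (mev Q x)ᵀ := by
    simp [mev_X_mul, (hW x hx).eq, Matrix.mul_assoc]
  exact congrFun (congrFun h i) j

end WeightedIntegral

section Quadrature

variable {p : ℕ} {a b : ℝ} {W : ℝ → Matrix (Fin p) (Fin p) ℝ}
  {P : ℕ → Polynomial (Matrix (Fin p) (Fin p) ℝ)}

/-- The `np × np` matrix whose `(l, i)` block is `P_l(x_i) (v_{i,1} ⋯ v_{i,m_i})`. -/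
noncomputable def nodeMat (P : ℕ → Polynomial (Matrix (Fin p) (Fin p) ℝ)) (n : ℕ) {k : ℕ}
    (x : Fin k → ℝ) (m : Fin k → ℕ) (v : (i : Fin k) → Fin (m i) → Fin p → ℝ) :
    Matrix (Fin n × Fin p) (LagIdx k m) ℝ :=
  Matrix.of fun lr c => (mev (P lr.1) (x c.1) * Vmat m v c.1) lr.2 c.2

lemma nodeMat_apply {n k : ℕ} (x : Fin k → ℝ) (m : Fin k → ℕ)
    (v : (i : Fin k) → Fin (m i) → Fin p → ℝ) (lr : Fin n × Fin p) (c : LagIdx k m) :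
    nodeMat P n x m v lr c = (mev (P lr.1) (x c.1) *ᵥ v c.1 c.2) lr.2 :=
  rfl

/-- The columns of `nodeMat` are eigenvectors of a symmetric matrix, with the nodes as
eigenvalues. -/
lemma IsOrthonormal.exists_isSymm_mul_nodeMat (hab : a < b) (hW : IsWeight p a b W)
    (hP : IsOrthonormal p a b W P) (n : ℕ) {k : ℕ} (x : Fin k → ℝ) (m : Fin k → ℕ)
    (v : (i : Fin k) → Fin (m i) → Fin p → ℝ)
    (hker : ∀ i j, mev (P n) (x i) *ᵥ v i j = 0) :
    ∃ T : Matrix (Fin n × Fin p) (Fin n × Fin p) ℝ, T.IsSymm ∧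
      T * nodeMat P n x m v = nodeMat P n x m v * Jmat x m := by
  have hexp : ∀ l : Fin n, ∃ c : ℕ → Matrix (Fin p) (Fin p) ℝ,
      X * P l = ∑ q ∈ Finset.range (n + 1), C (c q) * P q := fun l =>
    exists_eq_sum_C_mul hP.1 hP.2.1 _ _ <| by
      rw [degree_lt_iff_coeff_zero]
      intro i hi
      obtain ⟨i, rfl⟩ : ∃ i', i = i' + 1 := ⟨i - 1, by omega⟩
      rw [coeff_X_mul]
      exact coeff_eq_zero_of_natDegree_lt (by rw [hP.1]; omega)
  choose c hc using hexp
  have hcoef : ∀ l q : Fin n,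
      mInt a b (fun x => mev (X * P l) x * W x * (mev (P q) x)ᵀ) = c l q := fun l q => by
    rw [hc l]
    exact hP.mInt_sum_C_mul hab hW _ _ (by omega)
  refine ⟨Matrix.of fun lr qs => c lr.1 qs.1 lr.2 qs.2, ?_, ?_⟩
  · ext ⟨l, r⟩ ⟨q, s⟩
    have h := mInt_X_mul_comm hab hW.1 (P q) (P l)
    rw [hcoef, hcoef] at h
    exact congrFun (congrFun h r) s
  · ext ⟨l, r⟩ ⟨i, j⟩
    have h : mev (X * P l) (x i) *ᵥ v i j =
        ∑ q ∈ Finset.range (n + 1), c l q *ᵥ (mev (P q) (x i) *ᵥ v i j) := by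
      rw [hc l, mev_sum_C_mul, Matrix.sum_mulVec]
      simp only [Matrix.mulVec_mulVec]
    rw [Finset.sum_range_succ, hker, Matrix.mulVec_zero, add_zero, mev_X_mul,
      Matrix.smul_mulVec, Finset.sum_range] at h
    have h' := congrFun h r
    rw [Jmat, Matrix.mul_diagonal, Matrix.mul_apply, Fintype.sum_prod_type]
    simp only [nodeMat_apply, Matrix.of_apply]
    rw [mul_comm, ← smul_eq_mul, ← Pi.smul_apply, h', Finset.sum_apply]
    rfl

lemma IsOrthonormal.transpose_nodeMat_mul_self (hab : a < b) (hW : IsWeight p a b W)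
    (hP : IsOrthonormal p a b W P) (n : ℕ) {k : ℕ} {x : Fin k → ℝ}
    (hx : Function.Injective x) (m : Fin k → ℕ) (v : (i : Fin k) → Fin (m i) → Fin p → ℝ)
    (hker : ∀ i j, mev (P n) (x i) *ᵥ v i j = 0) :
    (nodeMat P n x m v)ᵀ * nodeMat P n x m v = Matrix.blockDiagonal' (Lmat P n x m v) := by
  obtain ⟨T, hT, hTA⟩ := hP.exists_isSymm_mul_nodeMat hab hW n x m v hker
  set A := nodeMat P n x m v with hA
  have hcomm : Aᵀ * A * Jmat x m = Jmat x m * (Aᵀ * A) := by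
    have hTA' : Aᵀ * T = Jmat x m * Aᵀ := by
      have h := congrArg Matrix.transpose hTA
      simpa [Matrix.transpose_mul, hT.eq, Jmat] using h
    rw [Matrix.mul_assoc, ← hTA, ← Matrix.mul_assoc, hTA', Matrix.mul_assoc]
  ext ⟨i, s⟩ ⟨j, t⟩
  rcases eq_or_ne i j with rfl | hij
  · rw [Matrix.blockDiagonal'_apply_eq]
    simp only [hA, Matrix.mul_apply, transpose_apply, nodeMat_apply, Fintype.sum_prod_type,
      Lmat, Kker, Matrix.of_apply, Matrix.sum_mulVec, dotProduct_sum, Finset.sum_range]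
    refine Finset.sum_congr rfl fun l _ => ?_
    rw [← Matrix.mulVec_mulVec, Matrix.dotProduct_mulVec, Matrix.vecMul_transpose]
    rfl
  · rw [Matrix.blockDiagonal'_apply_ne _ _ _ hij]
    have h := congrFun (congrFun hcomm ⟨i, s⟩) ⟨j, t⟩
    rw [Jmat, Matrix.mul_diagonal, Matrix.diagonal_mul] at h
    have hne : x j - x i ≠ 0 := sub_ne_zero.2 fun h => hij (hx h).symm
    refine (mul_eq_zero.1 (?_ : (x j - x i) * _ = 0)).resolve_left hne
    linear_combination h

lemma IsOrthonormal.exists_nodeMat_mul_eq_one (hP : IsOrthonormal p a b W P) (n : ℕ) {k : ℕ}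
    (x : Fin k → ℝ) (m : Fin k → ℕ) (v : (i : Fin k) → Fin (m i) → Fin p → ℝ)
    (e : (Fin n × Fin p) ≃ LagIdx k m) (he : IsUnit (colLag x m v e)) :
    ∃ R : Matrix (LagIdx k m) (Fin n × Fin p) ℝ,
      nodeMat P n x m v * R = 1 ∧ R * nodeMat P n x m v = 1 := by
  have hexp : ∀ l : Fin n, ∃ c : ℕ → Matrix (Fin p) (Fin p) ℝ,
      X ^ (l : ℕ) = ∑ q ∈ Finset.range n, C (c q) * P q := fun l =>
    exists_eq_sum_C_mul hP.1 hP.2.1 _ _ <|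
      (degree_X_pow_le _).trans_lt (by exact_mod_cast l.2)
  choose c hc using hexp
  set A := nodeMat P n x m v with hA
  have hmul : colLag x m v e =
      (Matrix.of fun lr qs : Fin n × Fin p => c lr.1 qs.1 lr.2 qs.2) * A.submatrix id e := by
    ext ⟨l, r⟩ d
    obtain ⟨⟨i, j⟩, hd⟩ : ∃ y, e d = y := ⟨_, rfl⟩
    have h : mev (X ^ (l : ℕ)) (x i) *ᵥ v i j =
        ∑ q ∈ Finset.range n, c l q *ᵥ (mev (P q) (x i) *ᵥ v i j) := by
      rw [hc l, mev_sum_C_mul, Matrix.sum_mulVec]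
      simp only [Matrix.mulVec_mulVec]
    rw [mev_X_pow, Matrix.smul_mulVec, Matrix.one_mulVec, Finset.sum_range] at h
    have h' := congrFun h r
    rw [Matrix.mul_apply, Fintype.sum_prod_type]
    simp only [colLag, Jmat, Matrix.diagonal_pow, Matrix.mul_diagonal, Matrix.of_apply, hd,
      Matrix.submatrix_apply, hA, nodeMat_apply, id]
    rw [Finset.sum_apply] at h'
    exact (mul_comm _ _).trans h'
  have hunit : IsUnit (A.submatrix id e) := by
    rw [Matrix.isUnit_iff_isUnit_det] at he ⊢
    rw [hmul, Matrix.det_mul] at he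
    exact isUnit_of_mul_isUnit_right he
  obtain ⟨R, hR, hR'⟩ := isUnit_iff_exists.1 hunit
  refine ⟨R.submatrix e.symm id, ?_, ?_⟩
  · have h := Matrix.submatrix_mul_equiv (A.submatrix id e) R id e.symm id
    simpa [hR] using h
  · have h := Matrix.submatrix_mul R (A.submatrix id e) e.symm id e.symm Function.bijective_id
    rw [hR', Matrix.submatrix_one_equiv] at h
    simpa using h.symm

lemma Matrix.blockDiagonal'_mul_blockDiagonal'_inv {o : Type*} [Fintype o] [DecidableEq o]
    {m' : o → Type*} [∀ i, Fintype (m' i)] [∀ i, DecidableEq (m' i)]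
    (L : ∀ i, Matrix (m' i) (m' i) ℝ) (E : Matrix (Σ i, m' i) (Σ i, m' i) ℝ)
    (hE : blockDiagonal' L * E = 1) :
    blockDiagonal' L * blockDiagonal' (fun i => (L i)⁻¹) = 1 := by
  rw [← blockDiagonal'_mul, ← blockDiagonal'_one]
  congr 1
  funext i
  refine Matrix.mul_nonsing_inv _ (Matrix.isUnit_det_of_right_inverse (B := blockDiag' E i) ?_)
  ext s t
  have h := congrFun (congrFun hE ⟨i, s⟩) ⟨i, t⟩
  rw [Matrix.mul_apply, Fintype.sum_sigma, Finset.sum_eq_single i] at h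
  · simpa [Matrix.mul_apply, Matrix.one_apply, blockDiag'_apply] using h
  · intro j _ hj
    exact Finset.sum_eq_zero fun u _ => by rw [blockDiagonal'_apply_ne _ _ _ hj.symm, zero_mul]
  · simp

/-- Discrete orthogonality of the `P_l` with respect to the quadrature coefficients. -/
lemma IsOrthonormal.sum_mev_mul_Lam (hab : a < b) (hW : IsWeight p a b W)
    (hP : IsOrthonormal p a b W P) {n : ℕ} {k : ℕ} {x : Fin k → ℝ}
    (hx : Function.Injective x) (m : Fin k → ℕ) (v : (i : Fin k) → Fin (m i) → Fin p → ℝ)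
    (hker : ∀ i j, mev (P n) (x i) *ᵥ v i j = 0)
    (e : (Fin n × Fin p) ≃ LagIdx k m) (he : IsUnit (colLag x m v e)) (l q : Fin n) :
    ∑ i, mev (P l) (x i) * Lam P n x m v i * (mev (P q) (x i))ᵀ = if l = q then 1 else 0 := by
  have hD := hP.transpose_nodeMat_mul_self hab hW n hx m v hker
  obtain ⟨R, hAR, hRA⟩ := hP.exists_nodeMat_mul_eq_one n x m v e he
  set A := nodeMat P n x m v with hA
  have hRA' : Aᵀ * Rᵀ = 1 := by rw [← Matrix.transpose_mul, hRA, Matrix.transpose_one]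
  have hAR' : Rᵀ * Aᵀ = 1 := by rw [← Matrix.transpose_mul, hAR, Matrix.transpose_one]
  have hE : Matrix.blockDiagonal' (Lmat P n x m v) * (R * Rᵀ) = 1 := by
    rw [← hD, Matrix.mul_assoc, ← Matrix.mul_assoc A, hAR, Matrix.one_mul, hRA']
  have hinv := Matrix.blockDiagonal'_mul_blockDiagonal'_inv _ _ hE
  have hone : A * Matrix.blockDiagonal' (fun i => (Lmat P n x m v i)⁻¹) * Aᵀ = 1 := by
    have h1 : Matrix.blockDiagonal' (fun i => (Lmat P n x m v i)⁻¹) = R * Rᵀ :=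
      left_inv_eq_right_inv (mul_eq_one_comm.1 hinv) hE
    rw [h1, ← Matrix.mul_assoc, hAR, Matrix.one_mul, hAR']
  ext r s
  have h := congrFun (congrFun hone (l, r)) (q, s)
  have hblock : ∀ i : Fin k, mev (P l) (x i) * Lam P n x m v i * (mev (P q) (x i))ᵀ =
      (mev (P l) (x i) * Vmat m v i) * (Lmat P n x m v i)⁻¹ *
        (mev (P q) (x i) * Vmat m v i)ᵀ := fun i => by
    simp only [Lam, Matrix.transpose_mul, Matrix.mul_assoc]
  rw [Matrix.mul_apply, Fintype.sum_sigma] at h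
  rw [Matrix.sum_apply]
  simp only [hblock]
  refine (Finset.sum_congr rfl fun i _ => ?_).trans (h.trans ?_)
  · rw [Matrix.mul_apply]
    refine Finset.sum_congr rfl fun t _ => ?_
    rw [Matrix.mul_apply, Matrix.mul_apply, Fintype.sum_sigma, Finset.sum_eq_single i]
    · simp only [Matrix.blockDiagonal'_apply_eq]
      rfl
    · intro j _ hj
      exact Finset.sum_eq_zero fun u _ => by
        rw [Matrix.blockDiagonal'_apply_ne _ _ _ hj, mul_zero]
    · simp
  · by_cases hlq : l = q <;> simp [Matrix.one_apply, hlq]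

lemma IsOrthonormal.sum_eval_mul_Lam (hab : a < b) (hW : IsWeight p a b W)
    (hP : IsOrthonormal p a b W P) {n : ℕ} {k : ℕ} {x : Fin k → ℝ}
    (hx : Function.Injective x) (m : Fin k → ℕ) (v : (i : Fin k) → Fin (m i) → Fin p → ℝ)
    (hker : ∀ i j, mev (P n) (x i) *ᵥ v i j = 0)
    (e : (Fin n × Fin p) ≃ LagIdx k m) (he : IsUnit (colLag x m v e)) (q : ℝ[X])
    (hq : q.natDegree < n) (s t : Fin p) :
    ∑ i, q.eval (x i) * Lam P n x m v i s t = ∫ y in a..b, q.eval y * W y s t := by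
  obtain ⟨c, hc⟩ := exists_eq_sum_C_mul hP.1 hP.2.1 n
    (q.map (algebraMap ℝ (Matrix (Fin p) (Fin p) ℝ)))
    (degree_map_le.trans_lt (degree_le_natDegree.trans_lt (by exact_mod_cast hq)))
  have hn : 0 < n := by omega
  have hint := hP.mInt_sum_C_mul hab hW n c hn
  rw [← hc, hP.2.2.1] at hint
  have hsum : ∑ i, mev (q.map (algebraMap ℝ (Matrix (Fin p) (Fin p) ℝ))) (x i) *
      Lam P n x m v i = c 0 := by
    have hdisc : ∀ l : Fin n, ∑ i, mev (P l) (x i) * Lam P n x m v i =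
        if l = ⟨0, hn⟩ then 1 else 0 := fun l => by
      simpa [hP.2.2.1, mev_one] using hP.sum_mev_mul_Lam hab hW hx m v hker e he l ⟨0, hn⟩
    simp only [hc, mev_sum_C_mul, Finset.sum_mul, Matrix.mul_assoc]
    rw [Finset.sum_comm, Finset.sum_range]
    simp only [← Finset.mul_sum, hdisc]
    simp
  have h := congrFun (congrFun (hsum.trans hint.symm) s) t
  simpa [mev_map_algebraMap, mev_one, mInt, Matrix.sum_apply] using h

lemma posSemidef_Lam (n : ℕ) {k : ℕ} (x : Fin k → ℝ) (m : Fin k → ℕ)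
    (v : (i : Fin k) → Fin (m i) → Fin p → ℝ) (i : Fin k) : (Lam P n x m v i).PosSemidef := by
  have hK : (Kker P n (x i) (x i)).PosSemidef :=
    Matrix.posSemidef_sum _ fun l _ => by
      simpa using Matrix.posSemidef_conjTranspose_mul_self (mev (P l) (x i))
  have hL : Lmat P n x m v i = (Vmat m v i)ᴴ * Kker P n (x i) (x i) * Vmat m v i := by
    ext s t
    rw [Matrix.mul_assoc]
    rfl
  have h := (hL ▸ hK.conjTranspose_mul_mul_same (Vmat m v i)).inv.mul_mul_conjTranspose_same
    (Vmat m v i)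
  simpa [Lam] using h

lemma Matrix.PosSemidef.abs_apply_le {ι : Type*} [Fintype ι] {M : Matrix ι ι ℝ}
    (hM : M.PosSemidef) (s t : ι) : |M s t| ≤ M s s + M t t := by
  classical
  have hsymm : M t s = M s t := by simpa using hM.isHermitian.apply s t
  have hadd := hM.dotProduct_mulVec_nonneg (Pi.single s 1 + Pi.single t 1)
  have hsub := hM.dotProduct_mulVec_nonneg (Pi.single s 1 - Pi.single t 1)
  have hs := hM.diag_nonneg (i := s)
  have ht := hM.diag_nonneg (i := t)
  simp [Matrix.mulVec_add, Matrix.mulVec_sub, hsymm] at hadd hsub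
  rw [abs_le]
  constructor <;> linarith

end Quadrature

/-- Quadrature rules with bounded total mass that are eventually exact on each polynomial
converge on continuous functions. -/
lemma tendsto_quadrature_of_eventually_exact {a b : ℝ} (hab : a < b) {w : ℝ → ℝ}
    (hw : IntervalIntegrable w volume a b) {k : ℕ → ℕ} {x : (n : ℕ) → Fin (k n) → ℝ}
    (hmem : ∀ n i, x n i ∈ Set.Icc a b) {μ : (n : ℕ) → Fin (k n) → ℝ} {M : ℝ}
    (hbound : ∀ᶠ n in Filter.atTop, ∑ i, |μ n i| ≤ M)
    (hexact : ∀ q : ℝ[X], ∀ᶠ n in Filter.atTop,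
      ∑ i, q.eval (x n i) * μ n i = ∫ y in a..b, q.eval y * w y)
    {f : ℝ → ℝ} (hf : ContinuousOn f (Set.Icc a b)) :
    Filter.Tendsto (fun n => ∑ i, f (x n i) * μ n i) Filter.atTop
      (nhds (∫ y in a..b, f y * w y)) := by
  rw [Metric.tendsto_nhds]
  intro ε hε
  set I := ∫ y in a..b, |w y| with hI
  have hI0 : 0 ≤ I := intervalIntegral.integral_nonneg hab.le fun _ _ => abs_nonneg _
  set δ := ε / (|M| + I + 1) with hδ
  have hden : 0 < |M| + I + 1 := by positivity
  have hδ0 : 0 < δ := by positivity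
  obtain ⟨q, hq⟩ := exists_polynomial_near_of_continuousOn a b f hf δ hδ0
  have hint : |(∫ y in a..b, q.eval y * w y) - ∫ y in a..b, f y * w y| ≤ δ * I := by
    have hu : Set.uIcc a b = Set.Icc a b := Set.uIcc_of_le hab.le
    rw [← intervalIntegral.integral_sub (hw.continuousOn_mul q.continuous.continuousOn)
      (hw.continuousOn_mul (by rwa [hu])), hI, ← intervalIntegral.integral_const_mul]
    rw [← Real.norm_eq_abs]
    refine intervalIntegral.norm_integral_le_of_norm_le hab.le (.of_forall fun y hy => ?_)
      (hw.abs.const_mul δ)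
    rw [← sub_mul, Real.norm_eq_abs, abs_mul]
    gcongr
    exact (hq y (Set.Ioc_subset_Icc_self hy)).le
  filter_upwards [hbound, hexact q] with n hn hqn
  have hsum : |∑ i, f (x n i) * μ n i - ∑ i, q.eval (x n i) * μ n i| ≤ δ * |M| := by
    rw [← Finset.sum_sub_distrib]
    calc |∑ i, (f (x n i) * μ n i - q.eval (x n i) * μ n i)|
        ≤ ∑ i, |f (x n i) * μ n i - q.eval (x n i) * μ n i| := Finset.abs_sum_le_sum_abs _ _
      _ ≤ ∑ i, δ * |μ n i| := by
          refine Finset.sum_le_sum fun i _ => ?_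
          rw [← sub_mul, abs_mul, abs_sub_comm]
          gcongr
          exact (hq _ (hmem n i)).le
      _ ≤ δ * |M| := by
          rw [← Finset.mul_sum]
          gcongr
          exact hn.trans (le_abs_self M)
  rw [Real.dist_eq]
  rw [hqn] at hsum
  calc |∑ i, f (x n i) * μ n i - ∫ y in a..b, f y * w y|
      ≤ δ * |M| + δ * I := (abs_sub_le _ _ _).trans (add_le_add hsum hint)
    _ < δ * (|M| + I + 1) := by nlinarith
    _ = ε := by rw [hδ]; field_simp

/-- Convergence of the Gaussian quadrature rules: for a normalized weight matrix `W` on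
`[a, b]` with orthonormal matrix polynomials `(Pₙ)`, Gaussian nodes
`x₁⁽ⁿ⁾, …, x_{kₙ}⁽ⁿ⁾ ∈ [a, b]` (the distinct zeros of `Pₙ`, with multiplicities
`mᵢ⁽ⁿ⁾` summing to `np`, rootvectors `vᵢⱼ⁽ⁿ⁾` and invertible `col(X Jˡ)`), and
quadrature coefficients `Λᵢ⁽ⁿ⁾`, for all continuous matrix functions `F, G` on
`[a, b]` the quadrature sums converge (entrywise) to `∫_a^b F(x) W(x) G(x)ᵀ dx`. -/
theorem gaussian_quadrature_convergence {p : ℕ} (a b : ℝ) (hab : a < b)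
    (W : ℝ → Matrix (Fin p) (Fin p) ℝ) (hW : IsWeight p a b W)
    (hnorm : mInt a b W = 1)
    (P : ℕ → Polynomial (Matrix (Fin p) (Fin p) ℝ))
    (hP : IsOrthonormal p a b W P)
    (k : ℕ → ℕ) (x : (n : ℕ) → Fin (k n) → ℝ)
    (hmem : ∀ n i, x n i ∈ Set.Icc a b)
    (hx : ∀ n, Function.Injective (x n))
    (m : (n : ℕ) → Fin (k n) → ℕ)
    (hmul : ∀ n, 1 ≤ n → ∀ i,
      ((matPolyEquiv.symm (P n)).det).rootMultiplicity (x n i) = m n i)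
    (hall : ∀ n, 1 ≤ n → ∀ z : ℝ,
      ((matPolyEquiv.symm (P n)).det).eval z = 0 → ∃ i, z = x n i)
    (hsum : ∀ n, 1 ≤ n → (∑ i, m n i) = n * p)
    (v : (n : ℕ) → (i : Fin (k n)) → Fin (m n i) → Fin p → ℝ)
    (hv : ∀ n i, LinearIndependent ℝ (v n i))
    (hker : ∀ n, 1 ≤ n → ∀ i j, mev (P n) (x n i) *ᵥ v n i j = 0)
    (hinv : ∀ n, 1 ≤ n → ∃ en : (Fin n × Fin p) ≃ LagIdx (k n) (m n),
      IsUnit (colLag (x n) (m n) (v n) en (n := n)))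
    (F G : ℝ → Matrix (Fin p) (Fin p) ℝ)
    (hF : ∀ r c, ContinuousOn (fun t => F t r c) (Set.Icc a b))
    (hG : ∀ r c, ContinuousOn (fun t => G t r c) (Set.Icc a b)) :
    ∀ r c : Fin p,
      Filter.Tendsto
        (fun n : ℕ =>
          (∑ i, F (x n i) * Lam P n (x n) (m n) (v n) i * (G (x n i))ᵀ) r c)
        Filter.atTop
        (nhds ((mInt a b fun t => F t * W t * (G t)ᵀ) r c)) := by
  have hexact : ∀ (s t : Fin p) (q : ℝ[X]), ∀ᶠ n in Filter.atTop,
      ∑ i, q.eval (x n i) * Lam P n (x n) (m n) (v n) i s t =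
        ∫ y in a..b, q.eval y * W y s t := fun s t q => by
    filter_upwards [Filter.eventually_gt_atTop q.natDegree] with n hn
    have hn1 : 1 ≤ n := by omega
    obtain ⟨e, he⟩ := hinv n hn1
    exact hP.sum_eval_mul_Lam hab hW (hx n) (m n) (v n) (hker n hn1) e he q hn s t
  have hbound : ∀ s t : Fin p, ∀ᶠ n in Filter.atTop,
      ∑ i, |Lam P n (x n) (m n) (v n) i s t| ≤ 2 := fun s t => by
    have hmass : ∀ s : Fin p, ∫ y in a..b, W y s s = 1 := fun s => by
      simpa [mInt] using congrFun (congrFun hnorm s) s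
    filter_upwards [hexact s s 1, hexact t t 1] with n hs ht
    simp only [eval_one, one_mul, hmass] at hs ht
    refine (Finset.sum_le_sum fun i _ =>
      (posSemidef_Lam n (x n) (m n) (v n) i).abs_apply_le s t).trans ?_
    rw [Finset.sum_add_distrib, hs, ht]
    norm_num
  intro r c
  rw [mInt_mul_weight_mul_apply hab hW.2.2.1 hF hG]
  have hsplit : ∀ n, (∑ i, F (x n i) * Lam P n (x n) (m n) (v n) i * (G (x n i))ᵀ) r c =
      ∑ t, ∑ s, ∑ i, F (x n i) r s * G (x n i) c t * Lam P n (x n) (m n) (v n) i s t :=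
    fun n => by
      simp only [Matrix.sum_apply, mul_mul_transpose_apply]
      rw [Finset.sum_comm]
      exact Finset.sum_congr rfl fun t _ => Finset.sum_comm
  simp only [hsplit]
  exact tendsto_finsetSum _ fun t _ => tendsto_finsetSum _ fun s _ =>
    tendsto_quadrature_of_eventually_exact hab (hW.2.2.1 s t) hmem (hbound s t) (hexact s t)
      ((hF r s).mul (hG c t))
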